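/- arXiv:1207.1691 — 3 statements merged into one kernel-verified Lean document; each statement's English description precedes it below -/
import Mathlib

section
/- (Low-dimensionality certificate) For any linear pencil A of symmetric α×α matrices, the spectrahedron S_A has empty interior in ℝ^n if and only if there exist a nonzero linear polynomial f ∈ ℝ[x]_1 and an sos-matrix S ∈ Sℝ[x]^{α×α} of degree at most 2 such that -f² = tr(A S) as polynomials. -/
open MvPolynomial Matrix
attribute [local instance] Matrix.frobeniusNormedAddCommGroup

noncomputable section

abbrev RP (n : ℕ) := MvPolynomial (Fin n) ℝ

/-- Evaluation of the linear pencil `A₀ + ∑ xᵢ Aᵢ` at a point `x ∈ ℝⁿ`. -/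
def pencilEval {n α : ℕ} (A0 : Matrix (Fin α) (Fin α) ℝ) (A : Fin n → Matrix (Fin α) (Fin α) ℝ)
    (x : Fin n → ℝ) : Matrix (Fin α) (Fin α) ℝ :=
  A0 + ∑ i, x i • A i

/-- The linear pencil `A₀ + ∑ xᵢ Aᵢ` as a matrix of polynomials. -/
def pencilPoly {n α : ℕ} (A0 : Matrix (Fin α) (Fin α) ℝ) (A : Fin n → Matrix (Fin α) (Fin α) ℝ) :
    Matrix (Fin α) (Fin α) (RP n) :=
  A0.map C + ∑ i, (X i : RP n) • (A i).map C

/-- `v^* M v` for a matrix of polynomials. -/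
def quadForm {n α : ℕ} (M : Matrix (Fin α) (Fin α) (RP n)) (v : Fin α → RP n) : RP n :=
  v ⬝ᵥ (M *ᵥ v)

/-- A sum of squares of polynomials. -/
def IsSos {n : ℕ} (p : RP n) : Prop := ∃ (k : ℕ) (q : Fin k → RP n), p = ∑ i, q i ^ 2

/-- An sos-matrix: a finite sum `∑ vⱼ vⱼ^*` with `vⱼ` vectors of polynomials. -/
def IsSosMatrix {n α : ℕ} (S : Matrix (Fin α) (Fin α) (RP n)) : Prop :=
  ∃ (k : ℕ) (v : Fin k → Fin α → RP n), S = ∑ j, Matrix.vecMulVec (v j) (v j)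

/-- Membership in the quadratic module `M_A` associated to the pencil. -/
def InQuadModule {n α : ℕ} (A0 : Matrix (Fin α) (Fin α) ℝ)
    (A : Fin n → Matrix (Fin α) (Fin α) ℝ) (p : RP n) : Prop :=
  ∃ s, IsSos s ∧ ∃ (k : ℕ) (v : Fin k → Fin α → RP n),
    p = s + ∑ j, quadForm (pencilPoly A0 A) (v j)

/-- Strong infeasibility: positive distance (Frobenius norm) between the range of the
pencil and the PSD cone. -/
def StronglyInfeasible {n α : ℕ} (A0 : Matrix (Fin α) (Fin α) ℝ)
    (A : Fin n → Matrix (Fin α) (Fin α) ℝ) : Prop :=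
  ∃ ε > (0:ℝ), ∀ (x : Fin n → ℝ) (B : Matrix (Fin α) (Fin α) ℝ), B.PosSemidef →
    ε ≤ dist (pencilEval A0 A x) B

/-- In a finite-dimensional space, the convex hull of a compact set is compact. -/
theorem isCompact_convexHull_of_isCompact {E : Type*} [NormedAddCommGroup E] [NormedSpace ℝ E]
    [FiniteDimensional ℝ E] {D : Set E} (hD : IsCompact D) : IsCompact (convexHull ℝ D) := by
  classical
  rcases D.eq_empty_or_nonempty with rfl | ⟨d0, hd0⟩
  · simp
  set N := Module.finrank ℝ E + 1 with hN
  have hc : IsCompact ((fun p : (Fin N → ℝ) × (Fin N → E) => ∑ i, p.1 i • p.2 i) ''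
      (stdSimplex ℝ (Fin N) ×ˢ Set.pi Set.univ (fun _ => D))) := by
    apply IsCompact.image
    · exact (isCompact_stdSimplex ℝ (Fin N)).prod (isCompact_univ_pi fun _ => hD)
    · fun_prop
  convert hc using 1
  apply Set.Subset.antisymm
  · intro x hx
    obtain ⟨ι, _, z, w, hz, hai, hw, hw1, hx⟩ := eq_pos_convex_span_of_mem_convexHull hx
    have hcard : Fintype.card ι ≤ N := by
      have := hai.card_le_finrank_succ
      have h2 := Submodule.finrank_le (vectorSpan ℝ (Set.range z))
      omega
    obtain ⟨e⟩ : Nonempty (ι ↪ Fin N) :=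
      Function.Embedding.nonempty_of_card_le (by simpa using hcard)
    have h0 : ∀ i, i ∉ Finset.univ.map e → Function.extend e w 0 i = 0 := by
      intro i hi
      rw [Function.extend_apply']
      · rfl
      · simpa using hi
    refine ⟨(Function.extend e w 0, Function.extend e z (fun _ => d0)), ⟨⟨?_, ?_⟩, ?_⟩, ?_⟩
    · intro i
      by_cases h : ∃ a, e a = i
      · obtain ⟨a, rfl⟩ := h
        simpa [e.injective.extend_apply] using (hw a).le
      · simp [Function.extend_apply' _ _ _ h]
    · rw [← Finset.sum_subset (Finset.subset_univ (Finset.univ.map e)) (fun i _ hi => h0 i hi)]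
      simpa [e.injective.extend_apply] using hw1
    · intro i _
      by_cases h : ∃ a, e a = i
      · obtain ⟨a, rfl⟩ := h
        simpa [e.injective.extend_apply] using hz ⟨a, rfl⟩
      · simpa [Function.extend_apply' _ _ _ h] using hd0
    · show ∑ i, Function.extend e w 0 i • Function.extend e z (fun _ => d0) i = x
      rw [← Finset.sum_subset (Finset.subset_univ (Finset.univ.map e))
        (fun i _ hi => by rw [h0 i hi, zero_smul])]
      simpa [e.injective.extend_apply] using hx
  · rintro _ ⟨⟨w, z⟩, ⟨⟨hw, hw1⟩, hz⟩, rfl⟩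
    exact (convex_convexHull ℝ D).sum_mem (fun i _ => hw i) hw1
      (fun i _ => subset_convexHull ℝ D (hz i trivial))

section Cert
variable {n α : ℕ}

/-- The polynomial `uᵀ A w`. -/
def linPoly (A0 : Matrix (Fin α) (Fin α) ℝ) (A : Fin n → Matrix (Fin α) (Fin α) ℝ)
    (u w : Fin α → ℝ) : RP n :=
  C (u ⬝ᵥ (A0 *ᵥ w)) + ∑ i, X i * C (u ⬝ᵥ (A i *ᵥ w))

theorem dot_pencilEval (A0 : Matrix (Fin α) (Fin α) ℝ) (A : Fin n → Matrix (Fin α) (Fin α) ℝ)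
    (u w : Fin α → ℝ) (x : Fin n → ℝ) :
    u ⬝ᵥ (pencilEval A0 A x *ᵥ w) = u ⬝ᵥ (A0 *ᵥ w) + ∑ i, x i * (u ⬝ᵥ (A i *ᵥ w)) := by
  simp [pencilEval, Matrix.add_mulVec, Matrix.sum_mulVec, dotProduct_sum, Matrix.smul_mulVec]

theorem eval_linPoly (A0 : Matrix (Fin α) (Fin α) ℝ) (A : Fin n → Matrix (Fin α) (Fin α) ℝ)
    (u w : Fin α → ℝ) (x : Fin n → ℝ) :
    eval x (linPoly A0 A u w) = u ⬝ᵥ (pencilEval A0 A x *ᵥ w) := by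
  rw [dot_pencilEval]; simp [linPoly]

theorem linPoly_degree (A0 : Matrix (Fin α) (Fin α) ℝ) (A : Fin n → Matrix (Fin α) (Fin α) ℝ)
    (u w : Fin α → ℝ) : (linPoly A0 A u w).totalDegree ≤ 1 := by
  refine (totalDegree_add _ _).trans (max_le (by simp) ?_)
  refine totalDegree_finsetSum_le fun i _ => (totalDegree_mul _ _).trans ?_
  simp

theorem pencilPoly_map (A0 : Matrix (Fin α) (Fin α) ℝ) (A : Fin n → Matrix (Fin α) (Fin α) ℝ)
    (x : Fin n → ℝ) : (pencilPoly A0 A).map (eval x) = pencilEval A0 A x := by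
  ext a b
  simp [pencilPoly, pencilEval, Matrix.sum_apply]

theorem eval_quadForm (A0 : Matrix (Fin α) (Fin α) ℝ) (A : Fin n → Matrix (Fin α) (Fin α) ℝ)
    (v : Fin α → RP n) (x : Fin n → ℝ) :
    eval x (quadForm (pencilPoly A0 A) v) =
      (fun a => eval x (v a)) ⬝ᵥ (pencilEval A0 A x *ᵥ (fun a => eval x (v a))) := by
  rw [← pencilPoly_map]
  simp [quadForm, dotProduct, Matrix.mulVec]

theorem trace_vecMulVec_eq (M : Matrix (Fin α) (Fin α) (RP n)) (v : Fin α → RP n) :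
    (M * Matrix.vecMulVec v v).trace = quadForm M v := by
  rw [Matrix.mul_vecMulVec, Matrix.trace_vecMulVec, quadForm, dotProduct_comm]

/-- `p` is of the form `tr(A S)` with `S` a quadratic sos-matrix. -/
def Cert (A0 : Matrix (Fin α) (Fin α) ℝ) (A : Fin n → Matrix (Fin α) (Fin α) ℝ)
    (p : RP n) : Prop :=
  ∃ S : Matrix (Fin α) (Fin α) (RP n), IsSosMatrix S ∧
          (∀ a b, (S a b).totalDegree ≤ 2) ∧ p = (pencilPoly A0 A * S).trace

variable {A0 : Matrix (Fin α) (Fin α) ℝ} {A : Fin n → Matrix (Fin α) (Fin α) ℝ}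

theorem Cert.zero : Cert A0 A 0 :=
  ⟨0, ⟨0, Fin.elim0, by simp⟩, by simp, by simp⟩

theorem Cert.add {p q : RP n} (hp : Cert A0 A p) (hq : Cert A0 A q) : Cert A0 A (p + q) := by
  obtain ⟨S, ⟨k, v, hv⟩, hS, rfl⟩ := hp
  obtain ⟨T, ⟨l, w, hw⟩, hT, rfl⟩ := hq
  refine ⟨S + T, ⟨k + l, Fin.append v w, ?_⟩, fun a b => ?_, ?_⟩
  · rw [Fin.sum_univ_add]; simp [hv, hw]
  · exact (totalDegree_add _ _).trans (max_le (hS a b) (hT a b))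
  · rw [Matrix.mul_add, Matrix.trace_add]

theorem Cert.quad (v : Fin α → RP n) (hv : ∀ a, (v a).totalDegree ≤ 1) :
    Cert A0 A (quadForm (pencilPoly A0 A) v) := by
  refine ⟨Matrix.vecMulVec v v, ⟨1, fun _ => v, by simp⟩, fun a b => ?_,
    (trace_vecMulVec_eq _ _).symm⟩
  have := totalDegree_mul (v a) (v b)
  have h1 := hv a
  have h2 := hv b
  simp only [Matrix.vecMulVec_apply]
  omega

theorem Cert.sum {ι : Type*} (s : Finset ι) (p : ι → RP n) (h : ∀ i ∈ s, Cert A0 A (p i)) :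
    Cert A0 A (∑ i ∈ s, p i) :=
  Finset.sum_induction _ _ (fun _ _ => Cert.add) Cert.zero h

/-- `g² uᵀ A u` is certified for `g` linear. -/
theorem Cert.sq_mul (g : RP n) (hg : g.totalDegree ≤ 1) (u : Fin α → ℝ) :
    Cert A0 A (g ^ 2 * linPoly A0 A u u) := by
  have h : Cert A0 A _ := Cert.quad (fun a => g * C (u a)) (fun a => by
    have := totalDegree_mul g (C (u a))
    simp only [totalDegree_C] at this
    omega)
  convert h using 1
  apply MvPolynomial.funext
  intro x
  rw [eval_quadForm, map_mul, eval_linPoly]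
  have : (fun a => eval x (g * C (u a))) = eval x g • u := by ext; simp
  rw [this]
  simp [Matrix.mulVec_smul]
  ring

theorem dot_symm {M : Matrix (Fin α) (Fin α) ℝ} (hM : M.IsSymm) (u w : Fin α → ℝ) :
    u ⬝ᵥ (M *ᵥ w) = w ⬝ᵥ (M *ᵥ u) := by
  rw [Matrix.dotProduct_mulVec, ← Matrix.mulVec_transpose, hM.eq, dotProduct_comm]

theorem pencilEval_isSymm (hA0 : A0.IsSymm) (hA : ∀ i, (A i).IsSymm) (x : Fin n → ℝ) :
    (pencilEval A0 A x).IsSymm := by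
  simp [pencilEval, Matrix.IsSymm, Matrix.transpose_add, Matrix.transpose_sum, hA0.eq,
    fun i => (hA i).eq]

/-- If `uᵀ A u = 0` then `-(uᵀ A w)²` is certified. -/
theorem Cert.neg_sq (hA0 : A0.IsSymm) (hA : ∀ i, (A i).IsSymm) (u w : Fin α → ℝ)
    (hu : linPoly A0 A u u = 0) : Cert A0 A (-(linPoly A0 A u w) ^ 2) := by
  set l := linPoly A0 A u w with hl
  set q := linPoly A0 A w w with hq
  have dl : l.totalDegree ≤ 1 := linPoly_degree _ _ _ _
  have dq : q.totalDegree ≤ 1 := linPoly_degree _ _ _ _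
  have h : Cert A0 A _ := Cert.quad (fun a => (1 + q) * C (-u a / 2) + l * C (w a)) (fun a => by
    refine (totalDegree_add _ _).trans (max_le ?_ ?_)
    · refine (totalDegree_mul _ _).trans ?_
      simp only [totalDegree_C, add_zero]
      exact (totalDegree_add _ _).trans (max_le (by simp) dq)
    · refine (totalDegree_mul _ _).trans ?_
      simpa only [totalDegree_C, add_zero] using dl)
  convert h using 1
  apply MvPolynomial.funext
  intro x
  rw [eval_quadForm]
  have hu' : u ⬝ᵥ (pencilEval A0 A x *ᵥ u) = 0 := by rw [← eval_linPoly, hu, map_zero]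
  have hl' : u ⬝ᵥ (pencilEval A0 A x *ᵥ w) = eval x l := by rw [← eval_linPoly]
  have hl2 : w ⬝ᵥ (pencilEval A0 A x *ᵥ u) = eval x l := by
    rw [dot_symm (pencilEval_isSymm hA0 hA x), hl']
  have hq' : w ⬝ᵥ (pencilEval A0 A x *ᵥ w) = eval x q := by rw [← eval_linPoly]
  have : (fun a => eval x ((1 + q) * C (-u a / 2) + l * C (w a))) =
      (-(1 + eval x q) / 2) • u + eval x l • w := by ext; simp; ring
  rw [this]
  simp only [Matrix.mulVec_add, Matrix.mulVec_smul, dotProduct_add, add_dotProduct,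
    dotProduct_smul, smul_dotProduct, hu', hl', hl2, hq', smul_eq_mul, map_neg, map_pow]
  ring

end Cert

/-- The easy direction. -/
theorem interior_empty_of_cert {n α : ℕ} (A0 : Matrix (Fin α) (Fin α) ℝ)
    (A : Fin n → Matrix (Fin α) (Fin α) ℝ) (f : RP n) (hf : f ≠ 0) (hc : Cert A0 A (-f ^ 2)) :
    interior {x : Fin n → ℝ | (pencilEval A0 A x).PosSemidef} = ∅ := by
  obtain ⟨S, ⟨k, v, rfl⟩, -, hS⟩ := hc
  by_contra hne
  obtain ⟨x0, hx0⟩ := Set.nonempty_iff_ne_empty.2 hne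
  have hz : ∀ x : Fin n → ℝ, (pencilEval A0 A x).PosSemidef → eval x f = 0 := by
    intro x hx
    have h1 := congrArg (eval x) hS
    rw [Matrix.mul_sum, Matrix.trace_sum, map_sum] at h1
    have h2 : 0 ≤ ∑ j, eval x (pencilPoly A0 A * Matrix.vecMulVec (v j) (v j)).trace := by
      refine Finset.sum_nonneg fun j _ => ?_
      rw [trace_vecMulVec_eq, eval_quadForm]
      simpa using hx.dotProduct_mulVec_nonneg (fun a => eval x (v j a))
    rw [← h1, map_neg, map_pow] at h2
    exact pow_eq_zero_iff (two_ne_zero) |>.1 (le_antisymm (by linarith) (sq_nonneg _))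
  obtain ⟨ε, hε, hb⟩ := Metric.isOpen_iff.1 isOpen_interior x0 hx0
  apply hf
  refine MvPolynomial.funext_set (fun i => Metric.ball (x0 i) ε) (fun i => ?_) fun x hx => ?_
  · rw [Real.ball_eq_Ioo]; exact Set.Ioo_infinite (by linarith)
  · rw [map_zero]
    apply hz
    apply interior_subset (hb _)
    rw [ball_pi _ hε]
    exact hx

/-- The hard direction. -/
theorem cert_of_interior_empty {n α : ℕ} (A0 : Matrix (Fin α) (Fin α) ℝ)
    (A : Fin n → Matrix (Fin α) (Fin α) ℝ) (hA0 : A0.IsSymm) (hA : ∀ i, (A i).IsSymm)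
    (hint : interior {x : Fin n → ℝ | (pencilEval A0 A x).PosSemidef} = ∅) :
    ∃ f : RP n, f ≠ 0 ∧ f.totalDegree ≤ 1 ∧ Cert A0 A (-f ^ 2) := by
  classical
  -- common kernel and a complement
  let U : Submodule ℝ (Fin α → ℝ) :=
    LinearMap.ker A0.mulVecLin ⊓ ⨅ i, LinearMap.ker (A i).mulVecLin
  have hU : ∀ u, u ∈ U ↔ A0 *ᵥ u = 0 ∧ ∀ i, A i *ᵥ u = 0 := by
    intro u; simp [U]
  obtain ⟨W, hUW⟩ := U.exists_isCompl
  let T : Set (Fin α → ℝ) := Metric.sphere 0 1 ∩ W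
  have hT : IsCompact T := (isCompact_sphere _ _).inter_right W.closed_of_finiteDimensional
  let φ : (Fin α → ℝ) → ℝ × (Fin n → ℝ) := fun u => (u ⬝ᵥ (A0 *ᵥ u), fun i => u ⬝ᵥ (A i *ᵥ u))
  have hφ : Continuous φ := by
    simp only [φ]
    fun_prop
  have hK := isCompact_convexHull_of_isCompact (hT.image hφ)
  let R : Set (ℝ × (Fin n → ℝ)) := {p | p.1 ≤ 0 ∧ p.2 = 0}
  have hRc : Convex ℝ R := by
    rintro ⟨a, b⟩ ⟨ha, hb⟩ ⟨c, d⟩ ⟨hc, hd⟩ s t hs ht hst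
    simp only at ha hb hc hd
    subst hb hd
    refine ⟨?_, by simp⟩
    simp only [Prod.smul_mk, Prod.mk_add_mk, smul_eq_mul]
    nlinarith
  have hRcl : IsClosed R :=
    (isClosed_le continuous_fst continuous_const).inter (isClosed_eq continuous_snd continuous_const)
  by_cases hdis : Disjoint (convexHull ℝ (φ '' T)) R
  · -- separation yields an interior point
    exfalso
    obtain ⟨g, s, t, hgs, hst, hgt⟩ :=
      geometric_hahn_banach_compact_closed (convex_convexHull ℝ _) hK hRc hRcl hdis
    have ht0 : t < 0 := by simpa using hgt 0 ⟨le_rfl, rfl⟩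
    have hg1 : g (1, 0) ≤ 0 := by
      by_contra hpos
      push Not at hpos
      have := hgt ((t / g (1, 0)) • (1, 0)) ⟨by
        simpa using (div_neg_of_neg_of_pos ht0 hpos).le, by simp⟩
      rw [map_smul, smul_eq_mul, div_mul_cancel₀ _ hpos.ne'] at this
      exact lt_irrefl _ this
    have hneg : ∀ u ∈ T, g (φ u) < 0 := fun u hu =>
      (hgs _ (subset_convexHull ℝ _ ⟨u, hu, rfl⟩)).trans (hst.trans ht0)
    have hev : ∀ᶠ ε : ℝ in nhds 0, ∀ u ∈ T, g (φ u) - ε * (φ u).1 < 0 := by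
      refine hT.eventually_forall_of_forall_eventually fun u hu => ?_
      have hcont : Continuous (fun z : ℝ × (Fin α → ℝ) => g (φ z.2) - z.1 * (φ z.2).1) := by
        fun_prop
      exact hcont.continuousAt.eventually_lt continuousAt_const (by simpa using hneg u hu)
    obtain ⟨ε, hε, hεpos⟩ :=
      ((hev.filter_mono nhdsWithin_le_nhds).and (self_mem_nhdsWithin (s := Set.Ioi (0:ℝ)))).exists
    have hεpos : 0 < ε := hεpos
    set c := ε - g (1, 0) with hc
    have hcpos : 0 < c := by linarith
    let x : Fin n → ℝ := fun i => -g (0, Pi.single i 1) / c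
    have hgdec : ∀ p : ℝ × (Fin n → ℝ), g p = p.1 * g (1, 0) + ∑ i, p.2 i * g (0, Pi.single i 1) := by
      intro p
      have : p = p.1 • ((1 : ℝ), (0 : Fin n → ℝ)) +
          ∑ i, p.2 i • ((0 : ℝ), (Pi.single i 1 : Fin n → ℝ)) := by
        refine Prod.ext ?_ ?_
        · simp [Prod.fst_sum]
        · ext j
          simp [Prod.snd_sum, Pi.single_apply]
      conv_lhs => rw [this]
      simp only [map_add, map_sum, map_smul, smul_eq_mul]
    have hxpos : ∀ u ∈ T, 0 < u ⬝ᵥ (pencilEval A0 A x *ᵥ u) := by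
      intro u hu
      have h1 := hε u hu
      rw [hgdec] at h1
      rw [dot_pencilEval]
      have h2 : c * (u ⬝ᵥ (A0 *ᵥ u) + ∑ i, x i * (u ⬝ᵥ (A i *ᵥ u))) =
          -((φ u).1 * g (1, 0) + ∑ i, (φ u).2 i * g (0, Pi.single i 1) - ε * (φ u).1) := by
        have h3 : c * ∑ i, x i * (u ⬝ᵥ (A i *ᵥ u)) =
            - ∑ i, (φ u).2 i * g (0, Pi.single i 1) := by
          rw [Finset.mul_sum, ← Finset.sum_neg_distrib]
          refine Finset.sum_congr rfl fun i _ => ?_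
          simp only [x, φ]
          field_simp
        rw [mul_add, h3]
        simp only [φ, hc]
        ring
      exact pos_of_mul_pos_right (by rw [h2]; linarith) hcpos.le
    have hopen : ∀ᶠ y in nhds x, ∀ u ∈ T, 0 < u ⬝ᵥ (pencilEval A0 A y *ᵥ u) := by
      refine hT.eventually_forall_of_forall_eventually fun u hu => ?_
      have hcont : Continuous (fun z : (Fin n → ℝ) × (Fin α → ℝ) =>
          z.2 ⬝ᵥ (pencilEval A0 A z.1 *ᵥ z.2)) := by
        simp only [dot_pencilEval]
        fun_prop
      exact continuousAt_const.eventually_lt hcont.continuousAt (hxpos u hu)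
    have hmem : x ∈ interior {x : Fin n → ℝ | (pencilEval A0 A x).PosSemidef} := by
      rw [mem_interior_iff_mem_nhds]
      filter_upwards [hopen] with y hy
      have hsym := pencilEval_isSymm hA0 hA y
      refine Matrix.PosSemidef.of_dotProduct_mulVec_nonneg ?_ fun v => ?_
      · rw [Matrix.IsHermitian, Matrix.conjTranspose_eq_transpose_of_trivial]; exact hsym
      · rw [star_trivial]
        obtain ⟨a, ha, b, hb, rfl⟩ := Submodule.mem_sup.1
          (show v ∈ U ⊔ W by rw [hUW.sup_eq_top]; trivial)
        have ha0 : pencilEval A0 A y *ᵥ a = 0 := by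
          have := (hU a).1 ha
          simp [pencilEval, Matrix.add_mulVec, Matrix.sum_mulVec, Matrix.smul_mulVec, this.1,
            this.2]
        rw [Matrix.mulVec_add, ha0, zero_add, add_dotProduct, dot_symm hsym a b, ha0,
          dotProduct_zero, zero_add]
        by_cases hb0 : b = 0
        · simp [hb0]
        · have hn : 0 < ‖b‖ := norm_pos_iff.2 hb0
          have := hy (‖b‖⁻¹ • b) ⟨by simp [norm_smul, hn.ne'], W.smul_mem _ hb⟩
          rw [Matrix.mulVec_smul, dotProduct_smul, smul_dotProduct, smul_eq_mul, smul_eq_mul] at this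
          have h5 : 0 < ‖b‖⁻¹ := inv_pos.2 hn
          exact (pos_of_mul_pos_right (pos_of_mul_pos_right this h5.le) h5.le).le
    rw [hint] at hmem
    exact hmem
  · -- algebraic certificate
    rw [Set.not_disjoint_iff] at hdis
    obtain ⟨p, hp, hp1, hp2⟩ := hdis
    obtain ⟨ι, _, w, z, hw0, hw1, hz, rfl⟩ := mem_convexHull_iff_exists_fintype.1 hp
    choose u hu hφu using hz
    set l : ι → RP n := fun j => linPoly A0 A (√(w j) • u j) (√(w j) • u j) with hl
    obtain ⟨c, hc, hcsum⟩ : ∃ c : ℝ, 0 ≤ c ∧ ∑ j, l j = -C c := by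
      refine ⟨_, neg_nonneg.2 hp1, ?_⟩
      apply MvPolynomial.funext
      intro x
      simp only [hl, map_sum, eval_linPoly, map_neg, eval_C, neg_neg, dot_pencilEval]
      have hsq : ∀ (j : ι) (M : Matrix (Fin α) (Fin α) ℝ),
          (√(w j) • u j) ⬝ᵥ (M *ᵥ (√(w j) • u j)) = w j * (u j ⬝ᵥ (M *ᵥ u j)) := by
        intro j M
        rw [Matrix.mulVec_smul, dotProduct_smul, smul_dotProduct, smul_eq_mul, smul_eq_mul,
          ← mul_assoc, Real.mul_self_sqrt (hw0 j)]
      simp only [hsq]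
      have h2 : ∀ i, ∑ j, w j * (u j ⬝ᵥ (A i *ᵥ u j)) = 0 := by
        intro i
        have := congrFun hp2 i
        simpa [Prod.snd_sum, ← hφu, φ] using this
      rw [Finset.sum_add_distrib, Finset.sum_comm]
      have h3 : ∑ i, ∑ j, x i * (w j * (u j ⬝ᵥ (A i *ᵥ u j))) = 0 := by
        refine Finset.sum_eq_zero fun i _ => ?_
        rw [← Finset.mul_sum, h2, mul_zero]
      rw [h3, add_zero]
      simp [Prod.fst_sum, ← hφu, φ]
    rcases hc.lt_or_eq with hc | rfl
    · refine ⟨C (√c), ?_, by simp, ?_⟩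
      · simpa using (Real.sqrt_pos.2 hc).ne'
      · rw [← C_pow, Real.sq_sqrt hc.le, ← hcsum]
        refine Cert.sum _ _ fun j _ => ?_
        simpa using Cert.sq_mul (A0 := A0) (A := A) 1 (by simp) (√(w j) • u j)
    · rw [C_0, neg_zero] at hcsum
      by_cases hall : ∀ j, l j = 0
      · obtain ⟨j, hj⟩ : ∃ j, w j ≠ 0 := by
          by_contra! h
          simp [h] at hw1
        have hwj : √(w j) ≠ 0 := (Real.sqrt_pos.2 ((hw0 j).lt_of_ne' hj)).ne'
        set v := √(w j) • u j with hv
        have hv0 : v ≠ 0 := by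
          refine smul_ne_zero hwj fun h => ?_
          have := (hu j).1
          rw [h] at this
          simp at this
        have hvW : v ∈ W := W.smul_mem _ (hu j).2
        have hvU : v ∉ U := fun h => hv0 (Submodule.disjoint_def.1 hUW.disjoint v h hvW)
        obtain ⟨y, hy⟩ : ∃ y, linPoly A0 A v y ≠ 0 := by
          by_contra! h
          apply hvU
          rw [hU]
          have key : ∀ (x : Fin n → ℝ) y, y ⬝ᵥ (pencilEval A0 A x *ᵥ v) = 0 := by
            intro x y
            rw [dot_symm (pencilEval_isSymm hA0 hA x), ← eval_linPoly, h, map_zero]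
          have key0 : ∀ y, y ⬝ᵥ (A0 *ᵥ v) = 0 := by
            intro y
            simpa [dot_pencilEval] using key 0 y
          refine ⟨dotProduct_eq_zero _ fun y => by rw [dotProduct_comm]; exact key0 y,
            fun i => dotProduct_eq_zero _ fun y => ?_⟩
          have := key (Pi.single i 1) y
          rw [dot_pencilEval, key0] at this
          rw [dotProduct_comm]
          simpa [Pi.single_apply] using this
        exact ⟨_, hy, linPoly_degree _ _ _ _, Cert.neg_sq hA0 hA v y (hall j)⟩
      · push Not at hall
        obtain ⟨j, hj⟩ := hall
        have dl : (l j).totalDegree ≤ 1 := linPoly_degree _ _ _ _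
        refine ⟨C 2 * l j, mul_ne_zero (by simp) hj, ?_, ?_⟩
        · refine (totalDegree_mul _ _).trans ?_
          simpa only [totalDegree_C, zero_add] using dl
        · have hrest : ∑ i ∈ Finset.univ.erase j, l i = - l j := by
            rw [← Finset.add_sum_erase _ _ (Finset.mem_univ j)] at hcsum
            exact eq_neg_of_add_eq_zero_right hcsum
          have heq : -(C 2 * l j) ^ 2 = (l j - 1) ^ 2 * l j +
              ∑ i ∈ Finset.univ.erase j, (l j + 1) ^ 2 * l i := by
            rw [← Finset.mul_sum, hrest]
            have : (C 2 : RP n) = 2 := map_ofNat C 2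
            rw [this]
            ring
          rw [heq]
          refine Cert.add (Cert.sq_mul _ ?_ _) (Cert.sum _ _ fun i _ => Cert.sq_mul _ ?_ _)
          · exact (totalDegree_sub _ _).trans (max_le dl (by simp))
          · exact (totalDegree_add _ _).trans (max_le dl (by simp))

/-- Low-dimensionality certificate: `S_A` has empty interior iff there is a nonzero linear
polynomial `f` and a quadratic sos-matrix `S` with `-f² = tr(A S)`. -/
theorem stmt_6 {n α : ℕ} (A0 : Matrix (Fin α) (Fin α) ℝ)
    (A : Fin n → Matrix (Fin α) (Fin α) ℝ) (hA0 : A0.IsSymm) (hA : ∀ i, (A i).IsSymm) :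
    interior {x : Fin n → ℝ | (pencilEval A0 A x).PosSemidef} = ∅ ↔
      ∃ f : RP n, f ≠ 0 ∧ f.totalDegree ≤ 1 ∧
        ∃ S : Matrix (Fin α) (Fin α) (RP n), IsSosMatrix S ∧
          (∀ a b, (S a b).totalDegree ≤ 2) ∧
          -f ^ 2 = (pencilPoly A0 A * S).trace := by
  constructor
  · exact cert_of_interior_empty A0 A hA0 hA
  · rintro ⟨f, hf, -, hc⟩
    exact interior_empty_of_cert A0 A f hf hc
end
end

section
/- (Nonlinear Farkas' lemma for SDP) A linear pencil A of symmetric α×α real matrices is infeasible (S_A = ∅) if and only if −1 ∈ M_A, i.e., there exist a sum of squares s ∈ ℝ[x] and finitely many v_i ∈ ℝ[x]^α with −1 = s + Σ_i v_i^* A v_i. -/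
open MvPolynomial Matrix
attribute [local instance] Matrix.frobeniusNormedAddCommGroup

noncomputable section

/-! ### Compactness of convex hulls in finite dimension -/

theorem aux_isCompact_convexHull {E : Type} [NormedAddCommGroup E] [NormedSpace ℝ E]
    [FiniteDimensional ℝ E] {S : Set E} (hS : IsCompact S) : IsCompact (convexHull ℝ S) := by
  classical
  rcases S.eq_empty_or_nonempty with rfl | ⟨x0, hx0⟩
  · simp
  set d := Module.finrank ℝ E + 1 with hd
  let F : (Fin d → ℝ) × (Fin d → E) → E := fun p => ∑ i, p.1 i • p.2 i
  have hF : Continuous F := by fun_prop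
  have hK : IsCompact ((stdSimplex ℝ (Fin d)) ×ˢ (Set.univ.pi fun _ : Fin d => S)) :=
    (isCompact_stdSimplex ℝ (Fin d)).prod (isCompact_univ_pi fun _ => hS)
  have := hK.image hF
  convert this using 1
  apply Set.Subset.antisymm
  · intro x hx
    obtain ⟨ι, hι, z, w, hz, haff, hw, hw1, hx⟩ := eq_pos_convex_span_of_mem_convexHull hx
    have hcard : Fintype.card ι ≤ Fintype.card (Fin d) := by
      rw [Fintype.card_fin]
      refine haff.card_le_finrank_succ.trans ?_
      exact Nat.succ_le_succ (Submodule.finrank_le _)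
    obtain ⟨e⟩ := Function.Embedding.nonempty_of_card_le hcard
    refine ⟨(Function.extend e w 0, Function.extend e z fun _ => x0), ⟨⟨?_, ?_⟩, ?_⟩, ?_⟩
    · intro i
      by_cases h : ∃ a, e a = i
      · obtain ⟨a, rfl⟩ := h
        simpa [e.injective.extend_apply] using (hw a).le
      · simp [Function.extend_apply' _ _ _ h]
    · rw [← hw1]
      symm
      apply Finset.sum_of_injOn e e.injective.injOn (by simp)
      · intro i _ hi
        have : ¬ ∃ a, e a = i := by simpa using hi
        simp [Function.extend_apply' _ _ _ this]
      · intro a _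
        simp [e.injective.extend_apply]
    · intro i _
      by_cases h : ∃ a, e a = i
      · obtain ⟨a, rfl⟩ := h
        simpa [e.injective.extend_apply] using hz ⟨a, rfl⟩
      · simpa [Function.extend_apply' _ _ _ h] using hx0
    · rw [← hx]
      symm
      apply Finset.sum_of_injOn e e.injective.injOn (by simp)
      · intro i _ hi
        have : ¬ ∃ a, e a = i := by simpa using hi
        simp [Function.extend_apply' _ _ _ this]
      · intro a _
        simp [e.injective.extend_apply]
  · rintro _ ⟨⟨w, z⟩, ⟨hw, hz⟩, rfl⟩
    exact (convex_convexHull ℝ S).sum_mem (fun i _ => hw.1 i) hw.2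
      (fun i _ => subset_convexHull ℝ S (hz i trivial))

/-! ### Quadratic modules and maximal ones -/

/-- Quadratic modules, as a predicate on subsets of a commutative ring. -/
structure QMod {R : Type} [CommRing R] (Q : Set R) : Prop where
  one : (1 : R) ∈ Q
  add : ∀ {a b}, a ∈ Q → b ∈ Q → a + b ∈ Q
  sq : ∀ (c : R) {a}, a ∈ Q → c ^ 2 * a ∈ Q

theorem QMod.square {R : Type} [CommRing R] {Q : Set R} (h : QMod Q) (c : R) : c ^ 2 ∈ Q := by
  simpa using h.sq c h.one

theorem QMod.zero {R : Type} [CommRing R] {Q : Set R} (h : QMod Q) : (0 : R) ∈ Q := by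
  simpa using h.sq 0 h.one

theorem QMod.exists_max {R : Type} [CommRing R] {M : Set R} (h : QMod M) (h1 : (-1 : R) ∉ M) :
    ∃ Q : Set R, M ⊆ Q ∧ QMod Q ∧ (-1 : R) ∉ Q ∧
      ∀ Q' : Set R, Q ⊆ Q' → QMod Q' → (-1 : R) ∉ Q' → Q' ⊆ Q := by
  have hz : ∀ c ⊆ {Q : Set R | QMod Q ∧ (-1 : R) ∉ Q}, IsChain (· ⊆ ·) c → c.Nonempty →
      ∃ ub ∈ {Q : Set R | QMod Q ∧ (-1 : R) ∉ Q}, ∀ s ∈ c, s ⊆ ub := by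
    intro c hc hchain hne
    refine ⟨⋃₀ c, ⟨⟨?_, ?_, ?_⟩, ?_⟩, fun s hs => Set.subset_sUnion_of_mem hs⟩
    · obtain ⟨s, hs⟩ := hne
      exact ⟨s, hs, (hc hs).1.one⟩
    · rintro a b ⟨s, hs, ha⟩ ⟨t, ht, hb⟩
      rcases hchain.total hs ht with hst | hst
      · exact ⟨t, ht, (hc ht).1.add (hst ha) hb⟩
      · exact ⟨s, hs, (hc hs).1.add ha (hst hb)⟩
    · rintro r a ⟨s, hs, ha⟩
      exact ⟨s, hs, (hc hs).1.sq r ha⟩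
    · rintro ⟨s, hs, ha⟩
      exact (hc hs).2 ha
  obtain ⟨Q, hMQ, hQ⟩ := zorn_subset_nonempty _ hz M ⟨h, h1⟩
  exact ⟨Q, hMQ, hQ.prop.1, hQ.prop.2, fun Q' h1 h2 h3 => hQ.le_of_ge ⟨h2, h3⟩ h1⟩

theorem QMod.mem_of_neg_sq {R : Type} [CommRing R] {Q : Set R} (h : QMod Q) (h1 : (-1 : R) ∉ Q)
    (hmax : ∀ Q' : Set R, Q ⊆ Q' → QMod Q' → (-1 : R) ∉ Q' → Q' ⊆ Q)
    {f : R} (hf : -f ^ 2 ∈ Q) : f ∈ Q := by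
  let Q' : Set R := {p | ∃ m ∈ Q, ∃ s, IsSumSq s ∧ p = m + s * f}
  by_contra hfQ
  have hQ' : QMod Q' := by
    refine ⟨⟨1, h.one, 0, IsSumSq.zero, by ring⟩, ?_, ?_⟩
    · rintro _ _ ⟨m, hm, s, hs, rfl⟩ ⟨m', hm', s', hs', rfl⟩
      exact ⟨m + m', h.add hm hm', s + s', hs.add hs', by ring⟩
    · rintro c _ ⟨m, hm, s, hs, rfl⟩
      exact ⟨c ^ 2 * m, h.sq c hm, c * c * s, (IsSumSq.mul_self c).mul hs, by ring⟩
  have hmem : (-1 : R) ∈ Q' := by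
    by_contra hn
    refine hfQ (hmax Q' (fun m hm => ⟨m, hm, 0, IsSumSq.zero, by ring⟩) hQ' hn ?_)
    exact ⟨0, h.zero, 1, IsSumSq.one, by ring⟩
  obtain ⟨m, hm, s, hs, he⟩ := hmem
  apply h1
  have e : (-1 : R) = (m + m) + (1 + s * f) ^ 2 + s ^ 2 * (-f ^ 2) := by
    have : m = -1 - s * f := by rw [he]; ring
    rw [this]; ring
  rw [e]
  exact h.add (h.add (h.add hm hm) (h.square _)) (h.sq s hf)

/-! ### The quadratic module of a pencil -/

theorem aux_sum_append {N : Type} {M : Type} [AddCommMonoid M] {k l : ℕ} (v : Fin k → N)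
    (w : Fin l → N) (g : N → M) :
    ∑ i, g (Fin.append v w i) = ∑ i, g (v i) + ∑ i, g (w i) := by
  simp [Fin.sum_univ_add]

theorem aux_quadForm_smul {n α : ℕ} (M : Matrix (Fin α) (Fin α) (RP n)) (c : RP n)
    (v : Fin α → RP n) : quadForm M (c • v) = c ^ 2 * quadForm M v := by
  simp only [quadForm, mulVec_smul, dotProduct_smul, smul_dotProduct, smul_eq_mul]
  ring

theorem aux_qmod {n α : ℕ} (A0 : Matrix (Fin α) (Fin α) ℝ)
    (A : Fin n → Matrix (Fin α) (Fin α) ℝ) : QMod {p : RP n | InQuadModule A0 A p} := by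
  refine ⟨?_, ?_, ?_⟩
  · exact ⟨1, ⟨1, fun _ => 1, by simp⟩, 0, fun i => i.elim0, by simp⟩
  · rintro _ _ ⟨_, ⟨k, q, rfl⟩, l, v, rfl⟩ ⟨_, ⟨k', q', rfl⟩, l', v', rfl⟩
    refine ⟨_, ⟨k + k', Fin.append q q', rfl⟩, l + l', Fin.append v v', ?_⟩
    rw [aux_sum_append q q' (fun x => x ^ 2), aux_sum_append v v' (quadForm (pencilPoly A0 A))]
    abel
  · rintro c _ ⟨_, ⟨k, q, rfl⟩, l, v, rfl⟩
    refine ⟨_, ⟨k, fun i => c * q i, rfl⟩, l, fun i => c • v i, ?_⟩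
    simp only [aux_quadForm_smul, mul_add, Finset.mul_sum, mul_pow]

theorem aux_quadForm_mem {n α : ℕ} (A0 : Matrix (Fin α) (Fin α) ℝ)
    (A : Fin n → Matrix (Fin α) (Fin α) ℝ) (v : Fin α → RP n) :
    InQuadModule A0 A (quadForm (pencilPoly A0 A) v) :=
  ⟨0, ⟨0, fun i => i.elim0, by simp⟩, 1, fun _ => v, by simp⟩

/-- Coefficient vectors of affine polynomials. -/
abbrev AffV (n : ℕ) := ℝ × (Fin n → ℝ)

/-- The affine polynomial with given coefficients. -/
def affP (n : ℕ) : AffV n →ₗ[ℝ] RP n where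
  toFun w := C w.1 + ∑ i, C (w.2 i) * X i
  map_add' w w' := by simp [add_mul, Finset.sum_add_distrib]; abel
  map_smul' c w := by simp [MvPolynomial.smul_eq_C_mul, Finset.mul_sum, mul_assoc]

/-- The bilinear form of the pencil with values in affine coefficient vectors. -/
def bil {n α : ℕ} (A0 : Matrix (Fin α) (Fin α) ℝ) (A : Fin n → Matrix (Fin α) (Fin α) ℝ)
    (u v : Fin α → ℝ) : AffV n := (u ⬝ᵥ A0 *ᵥ v, fun i => u ⬝ᵥ A i *ᵥ v)

theorem aux_CC {n α : ℕ} (B : Matrix (Fin α) (Fin α) ℝ) (u v : Fin α → ℝ) :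
    (fun i => (C (u i) : RP n)) ⬝ᵥ (B.map C *ᵥ fun i => C (v i)) = C (u ⬝ᵥ B *ᵥ v) := by
  simp [dotProduct, mulVec, Matrix.map_apply]

theorem affP_bil {n α : ℕ} (A0 : Matrix (Fin α) (Fin α) ℝ)
    (A : Fin n → Matrix (Fin α) (Fin α) ℝ) (u v : Fin α → ℝ) :
    affP n (bil A0 A u v) =
      (fun i => (C (u i) : RP n)) ⬝ᵥ (pencilPoly A0 A *ᵥ fun i => C (v i)) := by
  simp only [affP, bil, pencilPoly, LinearMap.coe_mk, AddHom.coe_mk, Matrix.add_mulVec,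
    Matrix.sum_mulVec, Matrix.smul_mulVec, dotProduct_add, dotProduct_sum, dotProduct_smul,
    aux_CC, smul_eq_mul]
  congr 1
  exact Finset.sum_congr rfl fun i _ => mul_comm _ _

theorem bil_comm {n α : ℕ} {A0 : Matrix (Fin α) (Fin α) ℝ}
    {A : Fin n → Matrix (Fin α) (Fin α) ℝ} (hA0 : A0.IsSymm) (hA : ∀ i, (A i).IsSymm)
    (u v : Fin α → ℝ) : bil A0 A u v = bil A0 A v u := by
  have key : ∀ B : Matrix (Fin α) (Fin α) ℝ, B.IsSymm → u ⬝ᵥ B *ᵥ v = v ⬝ᵥ B *ᵥ u := by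
    intro B hB
    rw [dotProduct_mulVec, dotProduct_comm, ← mulVec_transpose, hB.eq]
  simp [bil, key _ hA0, key _ (hA _)]

theorem bil_add_right {n α : ℕ} (A0 : Matrix (Fin α) (Fin α) ℝ)
    (A : Fin n → Matrix (Fin α) (Fin α) ℝ) (u v w : Fin α → ℝ) :
    bil A0 A u (v + w) = bil A0 A u v + bil A0 A u w := by
  ext <;> simp [bil, mulVec_add]

theorem bil_smul_right {n α : ℕ} (A0 : Matrix (Fin α) (Fin α) ℝ)
    (A : Fin n → Matrix (Fin α) (Fin α) ℝ) (c : ℝ) (u v : Fin α → ℝ) :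
    bil A0 A u (c • v) = c • bil A0 A u v := by
  ext <;> simp [bil, mulVec_smul]

theorem aux_quad_comb {n α : ℕ} (M : Matrix (Fin α) (Fin α) (RP n)) (p l : RP n)
    (u w : Fin α → RP n) :
    quadForm M (l • w + p • u) = l ^ 2 * (w ⬝ᵥ M *ᵥ w) + l * p * (w ⬝ᵥ M *ᵥ u)
      + l * p * (u ⬝ᵥ M *ᵥ w) + p ^ 2 * (u ⬝ᵥ M *ᵥ u) := by
  simp only [quadForm, mulVec_add, mulVec_smul, dotProduct_add, add_dotProduct, dotProduct_smul,
    smul_dotProduct, smul_eq_mul]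
  ring

theorem aux_exists {n α : ℕ} (A0 : Matrix (Fin α) (Fin α) ℝ)
    (A : Fin n → Matrix (Fin α) (Fin α) ℝ) (hA0 : A0.IsSymm) (hA : ∀ i, (A i).IsSymm)
    (hM : ¬ InQuadModule A0 A (-1)) : ∃ x : Fin n → ℝ, (pencilEval A0 A x).PosSemidef := by
  obtain ⟨Q, hMQ, hQ, h1, hmax⟩ := (aux_qmod A0 A).exists_max hM
  have hcone : ∀ (c : ℝ), 0 ≤ c → ∀ p ∈ Q, c • p ∈ Q := by
    intro c hc p hp
    have := hQ.sq (C (Real.sqrt c)) hp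
    rwa [← C_pow, Real.sq_sqrt hc, ← MvPolynomial.smul_eq_C_mul] at this
  -- the support of the maximal module
  let I : Submodule ℝ (RP n) :=
    { carrier := {p | p ∈ Q ∧ -p ∈ Q}
      zero_mem' := by simpa using hQ.zero
      add_mem' := by
        rintro a b ⟨ha, ha'⟩ ⟨hb, hb'⟩
        refine ⟨hQ.add ha hb, ?_⟩
        rw [neg_add]
        exact hQ.add ha' hb'
      smul_mem' := by
        rintro c p ⟨hp, hp'⟩
        rcases le_total 0 c with hc | hc
        · refine ⟨hcone c hc p hp, ?_⟩
          rw [← smul_neg]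
          exact hcone c hc _ hp'
        · have hc' : 0 ≤ -c := by linarith
          refine ⟨?_, ?_⟩
          · have := hcone _ hc' _ hp'
            simpa using this
          · have := hcone _ hc' _ hp
            simpa using this }
  have hIdef : ∀ p, p ∈ I ↔ p ∈ Q ∧ -p ∈ Q := fun p => Iff.rfl
  have hIsq : ∀ f : RP n, -f ^ 2 ∈ Q → f ∈ I := by
    intro f hf
    exact ⟨hQ.mem_of_neg_sq h1 hmax hf, hQ.mem_of_neg_sq h1 hmax (by simpa using hf)⟩
  let V : Submodule ℝ (AffV n) := I.comap (affP n)
  have hV : ∀ w, w ∈ V ↔ affP n w ∈ I := fun w => Iff.rfl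
  have hone : affP n (1, 0) = 1 := by simp [affP]
  have h1V : ((1, 0) : AffV n) ∉ V := by
    rw [hV, hone]
    exact fun h => h1 h.2
  let U : Submodule ℝ (Fin α → ℝ) :=
    { carrier := {u | ∀ v, bil A0 A v u ∈ V}
      zero_mem' := by
        intro v
        have := bil_smul_right A0 A 0 v 0
        simp only [zero_smul] at this
        rw [this]
        exact V.zero_mem
      add_mem' := by
        intro a b ha hb v
        rw [bil_add_right]
        exact V.add_mem (ha v) (hb v)
      smul_mem' := by
        intro c a ha v
        rw [bil_smul_right]
        exact V.smul_mem c (ha v) }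
  have hU : ∀ u, u ∈ U ↔ ∀ v, bil A0 A v u ∈ V := fun u => Iff.rfl
  -- key fact
  have hbQ : ∀ u, affP n (bil A0 A u u) ∈ Q := by
    intro u
    rw [affP_bil]
    exact hMQ (aux_quadForm_mem A0 A _)
  have key : ∀ u, bil A0 A u u ∈ V → u ∈ U := by
    intro u hu w
    rw [hV]
    apply hIsq
    set l := affP n (bil A0 A w u) with hl
    set a := affP n (bil A0 A w w) with ha
    set f := affP n (bil A0 A u u) with hf
    have hl' : affP n (bil A0 A u w) = l := by rw [hl, bil_comm hA0 hA]
    set p : RP n := C (1 / 2) * (-a - 1) with hp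
    have h2 : (2 : RP n) * C (1 / 2) = 1 := by
      have : (2 : RP n) = C 2 := (map_ofNat C 2).symm
      rw [this, ← C_mul]
      norm_num
    have hp2 : 2 * p = -a - 1 := by rw [hp, ← mul_assoc, h2, one_mul]
    have hm := hMQ (aux_quadForm_mem A0 A
      (l • (fun i => (C (w i) : RP n)) + p • (fun i => (C (u i) : RP n))))
    rw [aux_quad_comb, ← affP_bil, ← affP_bil, ← affP_bil, ← affP_bil, hl', ← hl, ← ha, ← hf] at hm
    have hfI : -f ∈ Q := hu.2
    have e : -l ^ 2 = (l ^ 2 * a + l * p * l + l * p * l + p ^ 2 * f) + p ^ 2 * (-f) := by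
      linear_combination (-l ^ 2) * hp2
    rw [e]
    exact hQ.add hm (hQ.sq p hfI)
  obtain ⟨U', hUU'⟩ := U.exists_isCompl
  let q : (Fin α → ℝ) → AffV n := fun u => bil A0 A u u
  have hq : Continuous q := by
    simp only [q, bil]
    refine Continuous.prodMk ?_ (continuous_pi fun i => ?_)
    · exact Continuous.dotProduct continuous_id (Continuous.matrix_mulVec continuous_const continuous_id)
    · exact Continuous.dotProduct continuous_id (Continuous.matrix_mulVec continuous_const continuous_id)
  let S : Set (AffV n) := insert (1, 0) (Set.image q (Metric.sphere 0 1 ∩ (U' : Set (Fin α → ℝ))))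
  have hS : IsCompact S :=
    (((isCompact_sphere 0 1).inter_right U'.closed_of_finiteDimensional).image hq).insert _
  let Y : Set (AffV n) := {w | affP n w ∈ Q ∧ w ∉ V}
  have hY : Convex ℝ Y := by
    rw [convex_iff_forall_pos]
    rintro w ⟨hw, hw'⟩ z ⟨hz, hz'⟩ a b ha hb hab
    refine ⟨?_, fun h => hw' ?_⟩
    · rw [map_add, map_smul, map_smul]
      exact hQ.add (hcone a ha.le _ hw) (hcone b hb.le _ hz)
    · have : a • w ∈ V := by
        refine ⟨?_, ?_⟩
        · rw [map_smul]
          exact hcone a ha.le _ hw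
        · have h2 := hQ.add h.2 (hcone b hb.le _ hz)
          rw [map_add, map_smul, map_smul] at h2
          rw [map_smul]
          convert h2 using 1
          abel
      exact (V.smul_mem_iff ha.ne').1 this
  have hSY : S ⊆ Y := by
    rintro w (rfl | ⟨u, ⟨hu1, hu2⟩, rfl⟩)
    · exact ⟨by rw [hone]; exact hQ.one, h1V⟩
    · refine ⟨hbQ u, fun h => ?_⟩
      have h0 : u = 0 := by
        have := hUU'.disjoint
        rw [Submodule.disjoint_def] at this
        exact this u (key u h) hu2
      rw [h0] at hu1
      simp at hu1
  have hdisj : Disjoint (convexHull ℝ S) (V : Set (AffV n)) := by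
    rw [Set.disjoint_left]
    intro w hw
    exact (convexHull_min hSY hY hw).2
  obtain ⟨f, s, t, hfs, hst, hft⟩ := geometric_hahn_banach_compact_closed (convex_convexHull ℝ S)
    (aux_isCompact_convexHull hS) V.convex V.closed_of_finiteDimensional hdisj
  have ht0 : t < 0 := by simpa using hft 0 V.zero_mem
  have hfV : ∀ w ∈ V, f w = 0 := by
    intro w hw
    by_contra hne
    have := hft (((t - 1) / f w) • w) (V.smul_mem _ hw)
    rw [map_smul, smul_eq_mul, div_mul_cancel₀ _ hne] at this
    linarith
  have hfS : ∀ w ∈ S, f w < 0 := fun w hw => by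
    have := hfs w (subset_convexHull ℝ S hw)
    linarith
  have hf1 : f (1, 0) < 0 := hfS _ (Set.mem_insert _ _)
  have hfU' : ∀ u ∈ U', f (q u) ≤ 0 := by
    intro u hu
    by_cases h0 : u = 0
    · have : q u = 0 := by
        subst h0
        ext <;> simp [q, bil]
      rw [this, map_zero]
    · have hn : ‖u‖ ≠ 0 := by simpa using h0
      have hmem : q (‖u‖⁻¹ • u) ∈ S := by
        refine Set.mem_insert_of_mem _ ⟨_, ⟨?_, U'.smul_mem _ hu⟩, rfl⟩
        simp [norm_smul, hn]
      have h3 := (hfS _ hmem).le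
      have h4 : q (‖u‖⁻¹ • u) = (‖u‖⁻¹ * ‖u‖⁻¹) • q u := by
        simp only [q]
        rw [bil_smul_right, bil_comm hA0 hA, bil_smul_right, smul_smul]
      rw [h4, map_smul, smul_eq_mul] at h3
      have h5 : 0 < ‖u‖⁻¹ * ‖u‖⁻¹ := by positivity
      by_contra hcon
      push Not at hcon
      have := mul_pos h5 hcon
      linarith
  have hfall : ∀ u, f (q u) ≤ 0 := by
    intro u
    have hu : u ∈ U ⊔ U' := by rw [hUU'.sup_eq_top]; trivial
    obtain ⟨y, hy, z, hz, rfl⟩ := Submodule.mem_sup.1 hu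
    have : q (y + z) = bil A0 A (y + z) y + bil A0 A z y + q z := by
      simp only [q]
      rw [bil_add_right, bil_comm hA0 hA (y + z) z, bil_add_right, add_assoc]
    rw [this, map_add, map_add, hfV _ (hy _), hfV _ (hy _)]
    simpa using hfU' z hz
  refine ⟨fun i => f (0, Pi.single i 1) / f (1, 0), ?_⟩
  refine Matrix.PosSemidef.of_dotProduct_mulVec_nonneg ?_ fun u => ?_
  · rw [Matrix.IsHermitian, conjTranspose_eq_transpose_of_trivial]
    simp [pencilEval, transpose_sum, hA0.eq, (hA _).eq]
  · have hfw : ∀ w : AffV n, f w = w.1 * f (1, 0) + ∑ i, w.2 i * f (0, Pi.single i 1) := by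
      intro w
      have : w = w.1 • ((1, 0) : AffV n) + ∑ i, w.2 i • ((0, Pi.single i 1) : AffV n) := by
        ext j
        · simp [Prod.fst_sum]
        · simp [Prod.snd_sum, Finset.sum_apply, Pi.single_apply]
      conv_lhs => rw [this]
      simp only [map_add, map_sum, map_smul, smul_eq_mul]
    have h6 := hfall u
    rw [hfw] at h6
    have h7 : star u ⬝ᵥ pencilEval A0 A (fun i => f (0, Pi.single i 1) / f (1, 0)) *ᵥ u
        = ((q u).1 * f (1, 0) + ∑ i, (q u).2 i * f (0, Pi.single i 1)) / f (1, 0) := by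
      simp only [pencilEval, star_trivial, Matrix.add_mulVec, Matrix.sum_mulVec,
        Matrix.smul_mulVec, dotProduct_add, dotProduct_sum, dotProduct_smul, q, bil, smul_eq_mul]
      rw [add_div, mul_div_cancel_right₀ _ hf1.ne, Finset.sum_div]
      congr 1
      exact Finset.sum_congr rfl fun i _ => by ring
    rw [h7]
    exact div_nonneg_of_nonpos h6 hf1.le

theorem aux_eval_quad {n α : ℕ} (A0 : Matrix (Fin α) (Fin α) ℝ)
    (A : Fin n → Matrix (Fin α) (Fin α) ℝ) (x : Fin n → ℝ) (v : Fin α → RP n) :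
    eval x (quadForm (pencilPoly A0 A) v) =
      (fun i => eval x (v i)) ⬝ᵥ pencilEval A0 A x *ᵥ (fun i => eval x (v i)) := by
  simp [quadForm, pencilPoly, pencilEval, dotProduct, mulVec, Matrix.sum_apply, map_sum]

/-- Nonlinear Farkas' lemma for SDP: `S_A = ∅` iff `-1 ∈ M_A`. -/
theorem stmt_15 {n α : ℕ} (A0 : Matrix (Fin α) (Fin α) ℝ)
    (A : Fin n → Matrix (Fin α) (Fin α) ℝ) (hA0 : A0.IsSymm) (hA : ∀ i, (A i).IsSymm) :
    (∀ x : Fin n → ℝ, ¬ (pencilEval A0 A x).PosSemidef) ↔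
      InQuadModule A0 A (-1) := by
  constructor
  · intro h
    by_contra hM
    obtain ⟨x, hx⟩ := aux_exists A0 A hA0 hA hM
    exact h x hx
  · rintro ⟨_, ⟨k, p, rfl⟩, l, v, he⟩ x hx
    have h := congrArg (eval x) he
    simp only [map_neg, map_one, map_add, map_sum, map_pow, aux_eval_quad] at h
    have h1 : 0 ≤ ∑ i, (eval x (p i)) ^ 2 := Finset.sum_nonneg fun i _ => sq_nonneg _
    have h2 : 0 ≤ ∑ j, (fun i => eval x (v j i)) ⬝ᵥ pencilEval A0 A x *ᵥ
        (fun i => eval x (v j i)) :=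
      Finset.sum_nonneg fun j _ => by
        simpa using hx.dotProduct_mulVec_nonneg (fun i => eval x (v j i))
    linarith
end
end

section
/- Let A be a linear pencil with nonempty spectrahedron S_A. Then S_A is bounded if and only if the quadratic module M_A is archimedean, i.e., there exists N ∈ ℕ with N − Σ_{i=1}^n x_i² ∈ M_A. -/
open MvPolynomial Matrix
attribute [local instance] Matrix.frobeniusNormedAddCommGroup

noncomputable section

namespace QM

variable {n α : ℕ} {A0 : Matrix (Fin α) (Fin α) ℝ} {A : Fin n → Matrix (Fin α) (Fin α) ℝ}

lemma IsSos.add' {p q : RP n} (hp : IsSos p) (hq : IsSos q) : IsSos (p + q) := by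
  obtain ⟨k, f, rfl⟩ := hp
  obtain ⟨l, g, rfl⟩ := hq
  exact ⟨k + l, Fin.append f g, by simp [Fin.sum_univ_add]⟩

lemma add_mem {p q : RP n} (hp : InQuadModule A0 A p) (hq : InQuadModule A0 A q) :
    InQuadModule A0 A (p + q) := by
  obtain ⟨s, hs, k, v, rfl⟩ := hp
  obtain ⟨t, ht, l, w, rfl⟩ := hq
  refine ⟨s + t, IsSos.add' hs ht, k + l, Fin.append v w, ?_⟩
  simp only [Fin.sum_univ_add, Fin.append_left, Fin.append_right]
  ring

lemma sq_mul_mem {p : RP n} (g : RP n) (hp : InQuadModule A0 A p) :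
    InQuadModule A0 A (g ^ 2 * p) := by
  obtain ⟨s, ⟨l, f, rfl⟩, k, v, rfl⟩ := hp
  refine ⟨_, ⟨l, fun i => g * f i, rfl⟩, k, fun j => g • v j, ?_⟩
  simp only [quadForm, mulVec_smul, smul_dotProduct, dotProduct_smul, smul_eq_mul, mul_add,
    Finset.mul_sum, mul_pow]
  congr 1
  exact Finset.sum_congr rfl fun j _ => by ring

lemma sq_mem (g : RP n) : InQuadModule A0 A (g ^ 2) :=
  ⟨g ^ 2, ⟨1, fun _ => g, by simp⟩, 0, Fin.elim0, by simp⟩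

lemma C_mem {r : ℝ} (hr : 0 ≤ r) : InQuadModule A0 A (C r : RP n) := by
  have := sq_mem (A0 := A0) (A := A) (C (Real.sqrt r) : RP n)
  rwa [← C_pow, Real.sq_sqrt hr] at this

lemma C_mul_mem {r : ℝ} (hr : 0 ≤ r) {p : RP n} (hp : InQuadModule A0 A p) :
    InQuadModule A0 A (C r * p) := by
  have := sq_mul_mem (C (Real.sqrt r) : RP n) hp
  rwa [← C_pow, Real.sq_sqrt hr] at this

lemma quad_mem (v : Fin α → RP n) : InQuadModule A0 A (quadForm (pencilPoly A0 A) v) :=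
  ⟨0, ⟨0, Fin.elim0, by simp⟩, 1, fun _ => v, by simp⟩

/-- coefficient vector -/
def qv (A : Fin n → Matrix (Fin α) (Fin α) ℝ) (v : Fin α → ℝ) : Fin n → ℝ :=
  fun i => v ⬝ᵥ (A i *ᵥ v)

lemma quad_const (v : Fin α → ℝ) :
    quadForm (pencilPoly A0 A) (fun a => (C (v a) : RP n)) =
      C (v ⬝ᵥ (A0 *ᵥ v)) + ∑ i, C (qv A v i) * X i := by
  have key : ∀ B : Matrix (Fin α) (Fin α) ℝ,
      (fun a => (C (v a) : RP n)) ⬝ᵥ (B.map C *ᵥ fun a => C (v a)) = C (v ⬝ᵥ (B *ᵥ v)) := by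
    intro B
    simp [dotProduct, mulVec, map_sum]
  simp only [quadForm, pencilPoly, add_mulVec, dotProduct_add, sum_mulVec, dotProduct_sum,
    smul_mulVec, dotProduct_smul, smul_eq_mul, key, qv]
  congr 1
  exact Finset.sum_congr rfl fun j _ => by ring

lemma pencil_quad (x : Fin n → ℝ) (v : Fin α → ℝ) :
    v ⬝ᵥ (pencilEval A0 A x *ᵥ v) = v ⬝ᵥ (A0 *ᵥ v) + ∑ i, x i * qv A v i := by
  simp only [pencilEval, add_mulVec, dotProduct_add, sum_mulVec, dotProduct_sum,
    smul_mulVec, dotProduct_smul, smul_eq_mul, qv]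

lemma eval_quad (x : Fin n → ℝ) (v : Fin α → RP n) :
    eval x (quadForm (pencilPoly A0 A) v) =
      (fun a => eval x (v a)) ⬝ᵥ (pencilEval A0 A x *ᵥ fun a => eval x (v a)) := by
  simp [quadForm, pencilPoly, pencilEval, dotProduct, mulVec, map_sum, Matrix.sum_apply]

lemma eval_nonneg {p : RP n} (hp : InQuadModule A0 A p) {x : Fin n → ℝ}
    (hx : (pencilEval A0 A x).PosSemidef) : 0 ≤ eval x p := by
  obtain ⟨s, ⟨l, f, rfl⟩, k, v, rfl⟩ := hp
  simp only [map_add, map_sum, map_pow, eval_quad]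
  refine add_nonneg (Finset.sum_nonneg fun i _ => sq_nonneg _) (Finset.sum_nonneg fun i _ => ?_)
  simpa using hx.dotProduct_mulVec_nonneg (fun a => eval x (v i a))

/-- the cone -/
def K (A : Fin n → Matrix (Fin α) (Fin α) ℝ) : AddSubmonoid (Fin n → ℝ) :=
  AddSubmonoid.closure (Set.range (qv A))

lemma smul_mem_K {c : ℝ} (hc : 0 ≤ c) {y : Fin n → ℝ} (hy : y ∈ K A) : c • y ∈ K A := by
  induction hy using AddSubmonoid.closure_induction with
  | mem y hy =>
    obtain ⟨v, rfl⟩ := hy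
    refine AddSubmonoid.subset_closure ⟨Real.sqrt c • v, ?_⟩
    ext i
    simp only [qv, mulVec_smul, smul_dotProduct, dotProduct_smul, smul_eq_mul, Pi.smul_apply]
    rw [← mul_assoc, Real.mul_self_sqrt hc]
  | zero => simpa using (K A).zero_mem
  | add y z _ _ hy hz => rw [smul_add]; exact (K A).add_mem hy hz

lemma convex_K : Convex ℝ (K A : Set (Fin n → ℝ)) :=
  fun _ hx _ hy _ _ ha hb _ => (K A).add_mem (smul_mem_K ha hx) (smul_mem_K hb hy)

lemma K_cert {y : Fin n → ℝ} (hy : y ∈ K A) :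
    ∃ r : ℝ, InQuadModule A0 A (C r + ∑ i, C (y i) * X i) := by
  induction hy using AddSubmonoid.closure_induction with
  | mem y hy =>
    obtain ⟨v, rfl⟩ := hy
    exact ⟨_, quad_const (A0 := A0) v ▸ quad_mem _⟩
  | zero => exact ⟨0, by simpa using C_mem (A0 := A0) (A := A) le_rfl⟩
  | add y z _ _ hy hz =>
    obtain ⟨r, hr⟩ := hy
    obtain ⟨s, hs⟩ := hz
    refine ⟨r + s, ?_⟩
    convert add_mem hr hs using 1
    simp only [Pi.add_apply, C_add, add_mul, Finset.sum_add_distrib]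
    ring

lemma K_top (h : ∀ f : (Fin n → ℝ) →ₗ[ℝ] ℝ, (∀ y ∈ K A, 0 ≤ f y) → f = 0) (y : Fin n → ℝ) :
    y ∈ K A := by
  have hspan : Submodule.span ℝ (K A : Set (Fin n → ℝ)) = ⊤ := by
    by_contra hne
    obtain ⟨f, hf, hle⟩ := Submodule.exists_le_ker_of_lt_top _ (lt_top_iff_ne_top.2 hne)
    refine hf (h f fun y hy => ?_)
    have : f y = 0 := hle (Submodule.subset_span hy)
    exact this.ge
  have haff : affineSpan ℝ (K A : Set (Fin n → ℝ)) = ⊤ := by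
    have h0 : insert (0 : Fin n → ℝ) (K A : Set (Fin n → ℝ)) = K A :=
      Set.insert_eq_of_mem (K A).zero_mem
    rw [← h0, ← AffineSubspace.coe_eq_univ_iff, affineSpan_insert_zero, hspan]
    rfl
  have hint := (convex_K (A := A)).interior_nonempty_iff_affineSpan_eq_top.2 haff
  by_contra hy
  obtain ⟨f, hf⟩ := geometric_hahn_banach_open_point (convex_K (A := A)).interior isOpen_interior
    (fun hh => hy (interior_subset hh))
  have hle : ∀ z ∈ K A, f z ≤ f y := by
    intro z hz
    have hz' : z ∈ closure (interior (K A : Set (Fin n → ℝ))) := by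
      rw [(convex_K (A := A)).closure_interior_eq_closure_of_nonempty_interior hint]
      exact subset_closure hz
    exact closure_minimal (fun a ha => (hf a ha).le)
      (isClosed_le f.continuous continuous_const) hz'
  have hneg : ∀ z ∈ K A, f z ≤ 0 := by
    intro z hz
    by_contra hpos
    push Not at hpos
    have h0 : 0 ≤ f y := by simpa using hle 0 (K A).zero_mem
    have := hle (((f y + 1) / f z) • z) (smul_mem_K (by positivity) hz)
    rw [map_smul, smul_eq_mul, div_mul_cancel₀ _ hpos.ne'] at this
    linarith
  have hf0 := h (-(f : (Fin n → ℝ) →ₗ[ℝ] ℝ)) (fun z hz => by simpa using hneg z hz)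
  have hfz : ∀ z, f z = 0 := fun z => by
    have := LinearMap.congr_fun hf0 z
    simpa using this
  obtain ⟨z, hz⟩ := hint
  have := hf z hz
  rw [hfz, hfz] at this
  exact lt_irrefl _ this

lemma dual_trivial (hA0 : A0.IsSymm) (hA : ∀ i, (A i).IsSymm)
    (hne : ∃ x : Fin n → ℝ, (pencilEval A0 A x).PosSemidef)
    (hb : Bornology.IsBounded {x : Fin n → ℝ | (pencilEval A0 A x).PosSemidef})
    (f : (Fin n → ℝ) →ₗ[ℝ] ℝ) (hf : ∀ y ∈ K A, 0 ≤ f y) : f = 0 := by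
  classical
  obtain ⟨x0, hx0⟩ := hne
  set d : Fin n → ℝ := fun i => f (Pi.single i 1) with hd
  have hfd : ∀ y, f y = ∑ i, d i * y i := by
    intro y
    conv_lhs => rw [pi_eq_sum_univ' y]
    rw [map_sum]
    refine Finset.sum_congr rfl fun i _ => ?_
    rw [map_smul, smul_eq_mul, mul_comm, hd]
  have hmem : ∀ t : ℝ, 0 ≤ t → (pencilEval A0 A (x0 + t • d)).PosSemidef := by
    intro t ht
    refine PosSemidef.of_dotProduct_mulVec_nonneg ?_ fun v => ?_
    · rw [IsHermitian, conjTranspose_eq_transpose_of_trivial]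
      simp only [pencilEval, transpose_add, transpose_sum, transpose_smul, hA0.eq, (hA _).eq]
    · have h1 := hx0.dotProduct_mulVec_nonneg v
      simp only [star_trivial, pencil_quad] at h1 ⊢
      have h2 := hf (qv A v) (AddSubmonoid.subset_closure ⟨v, rfl⟩)
      rw [hfd] at h2
      have h3 := mul_nonneg ht h2
      simp only [Pi.add_apply, Pi.smul_apply, smul_eq_mul, add_mul, Finset.sum_add_distrib,
        Finset.mul_sum, mul_assoc] at h3 ⊢
      linarith
  obtain ⟨R, hR⟩ := hb.exists_norm_le
  have hd0 : d = 0 := by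
    by_contra hdn
    have hpos : 0 < ‖d‖ := norm_pos_iff.2 hdn
    have hR0 : ‖x0‖ ≤ R := hR x0 hx0
    have hRn : 0 ≤ R := (norm_nonneg _).trans hR0
    set t : ℝ := (2 * R + 1) / ‖d‖ with ht
    have ht0 : 0 ≤ t := by positivity
    have h1 := hR _ (hmem t ht0)
    have h2 : ‖t • d‖ = 2 * R + 1 := by
      rw [norm_smul, Real.norm_of_nonneg ht0, ht, div_mul_cancel₀ _ hpos.ne']
    have h3 : ‖t • d‖ ≤ ‖x0 + t • d‖ + ‖x0‖ := by
      simpa using norm_sub_le (x0 + t • d) x0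
    linarith
  ext i
  simpa using congrFun hd0 i

lemma lin_mem (htop : ∀ y, y ∈ K A) (i : Fin n) (c : ℝ) :
    ∃ r : ℝ, InQuadModule A0 A (C r + C c * X i) := by
  classical
  obtain ⟨r, hr⟩ := K_cert (A0 := A0) (htop (Pi.single i c))
  refine ⟨r, ?_⟩
  convert hr using 2
  rw [Finset.sum_eq_single i]
  · simp
  · intro j _ hj
    simp [hj]
  · simp

lemma mono {r s : ℝ} (h : r ≤ s) {p : RP n} (hp : InQuadModule A0 A (C r + p)) :
    InQuadModule A0 A (C s + p) := by
  have := add_mem (C_mem (sub_nonneg.2 h)) hp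
  convert this using 1
  rw [← add_assoc, ← C_add, sub_add_cancel]

lemma sq_bound (htop : ∀ y, y ∈ K A) (i : Fin n) :
    ∃ r : ℝ, InQuadModule A0 A (C r - X i ^ 2) := by
  obtain ⟨r, hr⟩ := lin_mem (A0 := A0) htop i 1
  obtain ⟨s, hs⟩ := lin_mem (A0 := A0) htop i (-1)
  set N : ℝ := max 1 (max r s) with hN
  have hN1 : 1 ≤ N := le_max_left _ _
  have hr' := mono (s := N) (by simp [hN]) hr
  have hs' := mono (s := N) (by simp [hN]) hs
  have key := C_mul_mem (r := 1 / (2 * N)) (by positivity)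
    (add_mem (sq_mul_mem (C N + C (-1) * X i) hr') (sq_mul_mem (C N + C 1 * X i) hs'))
  refine ⟨N ^ 2, ?_⟩
  convert key using 1
  have hc : (C (1 / (2 * N)) * (2 * C N) : RP n) = 1 := by
    have : (2 : RP n) = C 2 := (map_ofNat C 2).symm
    rw [this, ← C_mul, ← C_mul, ← C_1]
    congr 1
    field_simp
  simp only [C_neg, C_1, C_pow]
  linear_combination (-(C N ^ 2 - X i ^ 2 : RP n)) * hc

lemma sum_bound (htop : ∀ y, y ∈ K A) (S : Finset (Fin n)) :
    ∃ r : ℝ, InQuadModule A0 A (C r - ∑ i ∈ S, X i ^ 2) := by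
  classical
  induction S using Finset.induction_on with
  | empty => exact ⟨0, by simpa using C_mem (A0 := A0) (A := A) le_rfl⟩
  | insert a S ha ih =>
    obtain ⟨r, hr⟩ := ih
    obtain ⟨s, hs⟩ := sq_bound (A0 := A0) htop a
    refine ⟨r + s, ?_⟩
    convert add_mem hr hs using 1
    rw [Finset.sum_insert ha, C_add]
    ring

end QM

/-- For a feasible pencil, `S_A` is bounded iff `M_A` is archimedean
(witnessed by `N − ∑ xᵢ² ∈ M_A`). -/
theorem stmt_17 {n α : ℕ} (A0 : Matrix (Fin α) (Fin α) ℝ)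
    (A : Fin n → Matrix (Fin α) (Fin α) ℝ) (hA0 : A0.IsSymm) (hA : ∀ i, (A i).IsSymm)
    (hne : ∃ x : Fin n → ℝ, (pencilEval A0 A x).PosSemidef) :
    Bornology.IsBounded {x : Fin n → ℝ | (pencilEval A0 A x).PosSemidef} ↔
      ∃ N : ℕ, InQuadModule A0 A ((N : RP n) - ∑ i, (X i : RP n) ^ 2) := by
  constructor
  · intro hb
    have htop := QM.K_top (QM.dual_trivial hA0 hA hne hb)
    obtain ⟨r, hr⟩ := QM.sum_bound (A0 := A0) htop Finset.univ
    obtain ⟨N, hN⟩ := exists_nat_ge r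
    refine ⟨N, ?_⟩
    rw [sub_eq_add_neg] at hr ⊢
    have := QM.mono hN hr
    rwa [map_natCast] at this
  · rintro ⟨N, hN⟩
    refine isBounded_iff_forall_norm_le.2 ⟨N, fun x hx => ?_⟩
    have h := QM.eval_nonneg hN hx
    simp only [map_sub, map_natCast, map_sum, map_pow, eval_X] at h
    refine (pi_norm_le_iff_of_nonneg (Nat.cast_nonneg N)).2 fun i => ?_
    have h1 : x i ^ 2 ≤ ∑ j, x j ^ 2 :=
      Finset.single_le_sum (f := fun j => x j ^ 2) (fun j _ => sq_nonneg _) (Finset.mem_univ i)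
    have h2 : (N : ℝ) ≤ (N : ℝ) ^ 2 := by exact_mod_cast Nat.le_self_pow two_ne_zero N
    exact abs_le_of_sq_le_sq (by linarith) (Nat.cast_nonneg N)
end
end
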